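/- arXiv:2504.17058 — 2 statements merged into one kernel-verified Lean document; each statement's English description precedes it below -/
import Mathlib

section
/- Let n be a positive integer, α ∈ (0,1), and let S_1, …, S_{n+1} be real-valued random variables on a probability space whose joint distribution is exchangeable. Let k = ⌈(1−α)(n+1)⌉ and suppose k ≤ n, and let q denote the k-th smallest value among S_1, …, S_n. Then P(S_{n+1} ≤ q) ≥ 1 − α. (This is the finite-sample validity guarantee underlying Theorem 1 of the paper: the conformal prediction region built from the calibration nonconformity scores covers a new generated sample's score with probability at least 1 − α.) -/
open MeasureTheory

/-- A finite sequence of random variables `S : Fin n → Ω → E` is *exchangeable* under `P` if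
for every permutation `σ` of the index set, the random vector `(S (σ 0), …, S (σ (n-1)))`
has the same joint distribution as `(S 0, …, S (n-1))`. -/
def Exchangeable {Ω E : Type*} [MeasurableSpace Ω] [MeasurableSpace E]
    (P : Measure Ω) {n : ℕ} (S : Fin n → Ω → E) : Prop :=
  ∀ σ : Equiv.Perm (Fin n),
    Measure.map (fun ω => fun i => S (σ i) ω) P = Measure.map (fun ω => fun i => S i ω) P

/-- The `k`-th smallest value (k-th order statistic, 1-indexed) of the values `s 0, …, s (n-1)`:
the `k`-th entry of the list sorted in nondecreasing order. -/
noncomputable def kthSmallest {n : ℕ} (s : Fin n → ℝ) (k : ℕ) : ℝ :=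
  ((List.ofFn s).mergeSort (· ≤ ·)).getD (k - 1) 0

lemma aux_countP {n : ℕ} (s : Fin n → ℝ) (t : ℝ) :
    (List.ofFn s).countP (fun x => decide (x < t)) =
      (Finset.univ.filter (fun i : Fin n => s i < t)).card := by
  induction n with
  | zero => simp
  | succ n ih =>
    rw [List.ofFn_succ, List.countP_cons, ih, Fin.card_filter_univ_succ]
    by_cases h : s 0 < t <;> simp [h, Function.comp_def]

lemma aux_kth {n : ℕ} (s : Fin n → ℝ) (k : ℕ) (hk0 : 0 < k) (hkn : k ≤ n) (t : ℝ)
    (h : kthSmallest s k < t) :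
    k ≤ (Finset.univ.filter (fun i : Fin n => s i < t)).card := by
  rw [← aux_countP]
  unfold kthSmallest at h
  have hp : ((List.ofFn s).mergeSort (· ≤ ·)).Perm (List.ofFn s) := List.mergeSort_perm _ _
  have hs : ((List.ofFn s).mergeSort (· ≤ ·)).Pairwise (· ≤ ·) := by
    exact List.pairwise_mergeSort' (· ≤ ·) (List.ofFn s)
  rw [← hp.countP_eq]
  have hlen : ((List.ofFn s).mergeSort (· ≤ ·)).length = n := by
    rw [hp.length_eq, List.length_ofFn]
  generalize (List.ofFn s).mergeSort (· ≤ ·) = l at *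
  rw [List.getD_eq_getElem _ _ (by omega)] at h
  have h1 : (l.take k).countP (fun x => decide (x < t)) = (l.take k).length := by
    rw [List.countP_eq_length]
    intro a ha
    obtain ⟨i, hi, rfl⟩ := List.mem_iff_getElem.1 ha
    have hi' : i < k := by
      have := hi
      rw [List.length_take] at this
      omega
    rw [List.getElem_take]
    simp only [decide_eq_true_eq]
    refine lt_of_le_of_lt ?_ h
    rcases Nat.lt_or_ge i (k-1) with h2 | h2
    · exact List.pairwise_iff_getElem.1 hs i (k-1) _ _ h2
    · have : i = k - 1 := by omega
      subst this
      exact le_rfl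
  have h2 := (List.take_sublist k l).countP_le (p := fun x => decide (x < t))
  rw [h1, List.length_take] at h2
  omega

lemma aux_rank {m : ℕ} (x : Fin m → ℝ) (k : ℕ) (hk : k ≤ m) :
    k ≤ (Finset.univ.filter (fun j : Fin m =>
      (Finset.univ.filter (fun i : Fin m => x i < x j)).card < k)).card := by
  have hm := Tuple.monotone_sort x
  set σ := Tuple.sort x
  have : (Finset.univ : Finset (Fin k)).card = k := by simp
  conv_lhs => rw [← this]
  refine Finset.card_le_card_of_injOn (fun a => σ (Fin.castLE hk a)) ?_ ?_
  · intro a _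
    simp only [Finset.coe_filter, Finset.mem_univ, true_and, Set.mem_setOf_eq]
    have : (Finset.univ.filter (fun i : Fin m => x i < x (σ (Fin.castLE hk a)))).card
        ≤ (Finset.range a).card := by
      refine Finset.card_le_card_of_injOn (fun i => (σ.symm i : ℕ)) ?_ ?_
      · intro i hi
        simp only [Finset.coe_filter, Finset.mem_univ, true_and, Set.mem_setOf_eq] at hi
        simp only [Finset.coe_range, Set.mem_Iio]
        by_contra hcon
        have h3 : Fin.castLE hk a ≤ σ.symm i := by
          rw [Fin.le_def]; simpa using hcon
        have := hm h3
        simp only [Function.comp_apply, Equiv.apply_symm_apply] at this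
        linarith
      · intro i _ j _ hij
        exact σ.symm.injective (Fin.ext hij)
    rw [Finset.card_range] at this
    omega
  · intro a _ b _ hab
    exact Fin.castLE_injective hk (σ.injective hab)

lemma aux_meas {m : ℕ} (k : ℕ) (j : Fin m) : MeasurableSet
    {x : Fin m → ℝ | (Finset.univ.filter (fun i : Fin m => x i < x j)).card < k} := by
  have : Measurable (fun x : Fin m → ℝ =>
      (Finset.univ.filter (fun i : Fin m => x i < x j)).card) := by
    simp only [Finset.card_filter]
    refine Finset.measurable_sum _ fun i _ => ?_
    exact Measurable.ite (measurableSet_lt (measurable_pi_apply i) (measurable_pi_apply j))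
      measurable_const measurable_const
  exact this (measurableSet_Iio (a := k))

lemma aux_perm {m : ℕ} (x : Fin m → ℝ) (σ : Equiv.Perm (Fin m)) (j : Fin m) :
    (Finset.univ.filter (fun i : Fin m => x (σ i) < x (σ j))).card =
    (Finset.univ.filter (fun i : Fin m => x i < x (σ j))).card := by
  refine Finset.card_bij (fun i _ => σ i) ?_ ?_ ?_
  · intro i hi; simpa using hi
  · intro a _ b _ h; exact σ.injective h
  · intro b hb; exact ⟨σ.symm b, by simpa using hb, by simp⟩

/-- **Finite-sample conformal validity** (the guarantee underlying Theorem 1):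
if the nonconformity scores `S 1, …, S (n+1)` are exchangeable, `k = ⌈(1-α)(n+1)⌉ ≤ n`, and
`q` is the `k`-th smallest of the calibration scores `S 1, …, S n`, then
`P(S (n+1) ≤ q) ≥ 1 - α`. -/
theorem conformal_finite_sample_validity
    {Ω : Type*} [MeasurableSpace Ω] (P : Measure Ω) [IsProbabilityMeasure P]
    (n : ℕ) (hn : 0 < n) (α : ℝ) (hα : α ∈ Set.Ioo (0 : ℝ) 1)
    (S : Fin (n + 1) → Ω → ℝ) (hSmeas : ∀ i, Measurable (S i))
    (hexch : Exchangeable P S)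
    (k : ℕ) (hk : k = ⌈(1 - α) * (n + 1 : ℝ)⌉₊) (hkn : k ≤ n) :
    1 - α ≤ (P {ω | S (Fin.last n) ω ≤
        kthSmallest (fun i : Fin n => S i.castSucc ω) k}).toReal := by
  obtain ⟨h0, h1⟩ := hα
  have hn1 : (0:ℝ) < n + 1 := by positivity
  have hkpos : 0 < k := by
    rw [hk, Nat.ceil_pos]
    exact mul_pos (by linarith) hn1
  have hkle : (1 - α) * (n + 1 : ℝ) ≤ k := by rw [hk]; exact Nat.le_ceil _
  let A : Fin (n+1) → Set (Fin (n+1) → ℝ) := fun j =>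
    {x | (Finset.univ.filter (fun i : Fin (n+1) => x i < x j)).card < k}
  have hA : ∀ j, MeasurableSet (A j) := fun j => aux_meas k j
  have hX : Measurable (fun ω => fun i => S i ω) := measurable_pi_lambda _ hSmeas
  let μ := Measure.map (fun ω => fun i => S i ω) P
  have hμ : IsProbabilityMeasure μ := Measure.isProbabilityMeasure_map hX.aemeasurable
  have heq : ∀ j, μ (A j) = μ (A (Fin.last n)) := by
    intro j
    have hσ := hexch (Equiv.swap (Fin.last n) j)
    have hX' : Measurable (fun ω => fun i => S (Equiv.swap (Fin.last n) j i) ω) :=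
      measurable_pi_lambda _ fun i => hSmeas _
    have : μ (A (Fin.last n)) =
        Measure.map (fun ω => fun i => S (Equiv.swap (Fin.last n) j i) ω) P
          (A (Fin.last n)) := by rw [hσ]
    rw [this, Measure.map_apply hX' (hA _)]
    simp only [μ]
    rw [Measure.map_apply hX (hA _)]
    congr 1
    ext ω
    have := aux_perm (fun i => S i ω) (Equiv.swap (Fin.last n) j) (Fin.last n)
    simp only [A, Set.mem_preimage, Set.mem_setOf_eq]
    rw [this, Equiv.swap_apply_left]
  have hsum : (k : ENNReal) ≤ ∑ j, μ (A j) := by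
    calc (k : ENNReal) = ∫⁻ _, (k : ENNReal) ∂μ := by simp
      _ ≤ ∫⁻ x, ∑ j, (A j).indicator 1 x ∂μ := by
        refine lintegral_mono fun x => ?_
        have h := aux_rank x k (by omega)
        rw [Finset.card_filter] at h
        have h' : (k : ENNReal) ≤ ((∑ j : Fin (n+1), if (Finset.univ.filter
          (fun i : Fin (n+1) => x i < x j)).card < k then 1 else 0 : ℕ) : ENNReal) := by
          exact_mod_cast h
        refine h'.trans (le_of_eq ?_)
        rw [Nat.cast_sum]
        refine Finset.sum_congr rfl fun j _ => ?_
        simp [Set.indicator_apply, A]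
      _ = ∑ j, μ (A j) := by
        rw [lintegral_finsetSum _ fun j _ => measurable_one.indicator (hA j)]
        simp [lintegral_indicator_one (hA _)]
  have hfin : (k : ℝ) ≤ (n + 1) * (μ (A (Fin.last n))).toReal := by
    simp only [heq, Finset.sum_const, Finset.card_univ, Fintype.card_fin, nsmul_eq_mul] at hsum
    have := ENNReal.toReal_mono
      (ENNReal.mul_ne_top (ENNReal.natCast_ne_top _) (measure_ne_top μ _)) hsum
    rw [ENNReal.toReal_mul, ENNReal.toReal_natCast, ENNReal.toReal_natCast] at this
    push_cast at this
    exact this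
  have hle : μ (A (Fin.last n)) ≤ P {ω | S (Fin.last n) ω ≤
        kthSmallest (fun i : Fin n => S i.castSucc ω) k} := by
    simp only [μ]
    rw [Measure.map_apply hX (hA _)]
    refine measure_mono fun ω hω => ?_
    simp only [A, Set.mem_preimage, Set.mem_setOf_eq] at hω ⊢
    by_contra hcon
    have h3 := aux_kth _ k hkpos hkn _ (not_le.1 hcon)
    have h4 : (Finset.univ.filter (fun i : Fin n => S i.castSucc ω < S (Fin.last n) ω)).card ≤
        (Finset.univ.filter (fun i : Fin (n+1) => S i ω < S (Fin.last n) ω)).card := by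
      refine Finset.card_le_card_of_injOn Fin.castSucc ?_ ?_
      · intro i hi; simpa using hi
      · exact (Fin.castSucc_injective n).injOn
    omega
  have hle' := ENNReal.toReal_mono (measure_ne_top P _) hle
  refine le_trans ?_ hle'
  have : (n + 1 : ℝ) * (1 - α) ≤ (n + 1) * (μ (A (Fin.last n))).toReal := by linarith
  exact le_of_mul_le_mul_left this hn1
end

section
/- Let n be a positive integer, α ∈ (0,1), and let S_1, …, S_{n+1} be real-valued random variables on a probability space whose joint distribution is exchangeable, and suppose that almost surely the values S_1, …, S_{n+1} are pairwise distinct. Let k = ⌈(1−α)(n+1)⌉ and suppose k ≤ n, and let q denote the k-th smallest value among S_1, …, S_n. Then P(S_{n+1} ≤ q) ≤ 1 − α + 1/(n+1). (Combined with the lower bound 1 − α, this makes precise the paper's claim in the proof of Theorem 1 that the coverage inequality becomes exact as n → ∞.) -/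
open MeasureTheory

lemma aux_card_lt {n : ℕ} (s : Fin n → ℝ) (k : ℕ) (hk : 1 ≤ k) (hkn : k ≤ n) :
    (Finset.univ.filter fun i => s i < kthSmallest s k).card ≤ k - 1 := by
  set q := kthSmallest s k with hq
  set l := (List.ofFn s).mergeSort (· ≤ ·) with hl
  have hlen : l.length = n := by simp [hl]
  have hperm : l.Perm (List.ofFn s) := List.mergeSort_perm _ _
  have hsort : l.Pairwise (· ≤ ·) := by
    have := List.pairwise_mergeSort (le := fun a b : ℝ => decide (a ≤ b))
      (by intro a b c; simpa using le_trans) (by intro a b; simpa using le_total a b) (List.ofFn s)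
    simpa using this
  have hlt : k - 1 < l.length := by omega
  have hqe : q = l[k - 1] := by
    rw [hq]; unfold kthSmallest
    rw [List.getD_eq_getElem _ _ hlt]
  have h1 : (Finset.univ.filter fun i => s i < q).card = l.countP (fun a => decide (a < q)) := by
    rw [hperm.countP_eq, ← Multiset.coe_countP (p := fun a => a < q), ← Fin.univ_val_map,
      Multiset.countP_map]
    rfl
  rw [h1, ← List.take_append_drop (k - 1) l, List.countP_append]
  have h2 : (l.drop (k - 1)).countP (fun a => decide (a < q)) = 0 := by
    rw [List.countP_eq_zero]
    intro a ha
    rw [List.mem_iff_getElem] at ha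
    obtain ⟨m, hm, rfl⟩ := ha
    simp only [List.getElem_drop, decide_eq_true_eq, not_lt, hqe]
    exact hsort.sortedLE.getElem_le_getElem_of_le (by omega)
  have h3 := List.countP_le_length (p := fun a => decide (a < q)) (l := l.take (k - 1))
  rw [List.length_take] at h3
  omega

/-- Number of entries strictly below entry `j`. -/
noncomputable def rk {m : ℕ} (x : Fin m → ℝ) (j : Fin m) : ℕ :=
  (Finset.univ.filter fun i => x i < x j).card

lemma rk_lt {m : ℕ} (x : Fin m → ℝ) {a b : Fin m} (h : x a < x b) : rk x a < rk x b := by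
  apply Finset.card_lt_card
  rw [Finset.ssubset_iff_of_subset]
  · exact ⟨a, by simpa using h, by simp⟩
  · intro i; simp only [Finset.mem_filter, Finset.mem_univ, true_and]; intro hi; exact hi.trans h

lemma card_rk {m : ℕ} (x : Fin m → ℝ) (hx : Function.Injective x) (k : ℕ) :
    (Finset.univ.filter fun j => rk x j < k).card ≤ k := by
  rw [← Finset.card_range k]
  conv_lhs => rw [Finset.card_range]
  apply Finset.card_le_card_of_injOn (rk x)
  · intro j hj; simpa using hj
  · intro a _ b _ hab
    rcases lt_trichotomy (x a) (x b) with h | h | h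
    · exact absurd hab (rk_lt x h).ne
    · exact hx h
    · exact absurd hab (rk_lt x h).ne'

lemma measurable_rk {m : ℕ} (j : Fin m) : Measurable fun x : Fin m → ℝ => rk x j := by
  unfold rk
  simp only [Finset.card_filter]
  refine Finset.measurable_sum _ fun i _ => Measurable.ite ?_ measurable_const measurable_const
  exact measurableSet_lt (measurable_pi_apply i) (measurable_pi_apply j)

lemma rk_perm {m : ℕ} (x : Fin m → ℝ) (σ : Equiv.Perm (Fin m)) (j : Fin m) :
    rk (fun i => x (σ i)) j = rk x (σ j) := by
  unfold rk
  apply Finset.card_equiv σ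
  intro i; simp

/-- **Conformal coverage upper bound**: if the exchangeable scores `S 1, …, S (n+1)` are
almost surely pairwise distinct, `k = ⌈(1-α)(n+1)⌉ ≤ n`, and `q` is the `k`-th smallest of
`S 1, …, S n`, then `P(S (n+1) ≤ q) ≤ 1 - α + 1/(n+1)`. -/
theorem conformal_coverage_upper_bound
    {Ω : Type*} [MeasurableSpace Ω] (P : Measure Ω) [IsProbabilityMeasure P]
    (n : ℕ) (hn : 0 < n) (α : ℝ) (hα : α ∈ Set.Ioo (0 : ℝ) 1)
    (S : Fin (n + 1) → Ω → ℝ) (hSmeas : ∀ i, Measurable (S i))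
    (hexch : Exchangeable P S)
    (hdist : ∀ᵐ ω ∂P, Function.Injective fun i => S i ω)
    (k : ℕ) (hk : k = ⌈(1 - α) * (n + 1 : ℝ)⌉₊) (hkn : k ≤ n) :
    (P {ω | S (Fin.last n) ω ≤
        kthSmallest (fun i : Fin n => S i.castSucc ω) k}).toReal
      ≤ 1 - α + 1 / (n + 1) := by
  have hk1 : 1 ≤ k := by
    rw [hk, Nat.one_le_ceil_iff]
    have := hα.2
    apply mul_pos (by linarith) (by positivity)
  have hkle : (k : ℝ) ≤ (1 - α) * (n + 1) + 1 := by
    rw [hk]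
    have := hα.2
    exact (Nat.ceil_lt_add_one (mul_nonneg (by linarith) (by positivity))).le
  have hSm : Measurable fun ω => fun i => S i ω := measurable_pi_lambda _ hSmeas
  let B : Fin (n + 1) → Set Ω := fun j => {ω | rk (fun i => S i ω) j < k}
  have hA : ∀ j : Fin (n + 1), MeasurableSet {x : Fin (n + 1) → ℝ | rk x j < k} := fun j =>
    measurableSet_lt (measurable_rk j) measurable_const
  have hB : ∀ j, MeasurableSet (B j) := fun j => hSm (hA j)
  have hsub : {ω | S (Fin.last n) ω ≤
        kthSmallest (fun i : Fin n => S i.castSucc ω) k} ⊆ B (Fin.last n) := by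
    intro ω hω
    simp only [Set.mem_setOf_eq] at hω
    have h := aux_card_lt (fun i : Fin n => S i.castSucc ω) k hk1 hkn
    have h2 : rk (fun i => S i ω) (Fin.last n) ≤ (Finset.univ.filter fun i : Fin n =>
        S i.castSucc ω < kthSmallest (fun i : Fin n => S i.castSucc ω) k).card := by
      unfold rk
      rw [Finset.card_filter, Finset.card_filter, Fin.sum_univ_castSucc]
      simp only [lt_irrefl, if_false, add_zero]
      apply Finset.sum_le_sum
      intro i _
      split_ifs with h3 h4
      · exact le_rfl
      · exact absurd (h3.trans_le hω) h4
      · exact Nat.zero_le _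
      · exact le_rfl
    show rk (fun i => S i ω) (Fin.last n) < k
    omega
  have heq : ∀ j, P (B j) = P (B (Fin.last n)) := by
    intro j
    let σ := Equiv.swap j (Fin.last n)
    have hσm : Measurable fun ω => fun i => S (σ i) ω :=
      measurable_pi_lambda _ fun i => hSmeas _
    have h := congrArg (fun μ => μ {x : Fin (n + 1) → ℝ | rk x (Fin.last n) < k}) (hexch σ)
    simp only [Measure.map_apply hσm (hA _), Measure.map_apply hSm (hA _)] at h
    rw [show B (Fin.last n) = (fun ω => fun i => S i ω) ⁻¹' {x | rk x (Fin.last n) < k} from rfl,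
      ← h]
    congr 1
    ext ω
    simp only [B, Set.mem_preimage, Set.mem_setOf_eq]
    rw [rk_perm (fun i => S i ω) σ]
    simp [σ]
  have hsum : ∑ j, P (B j) ≤ (k : ENNReal) := by
    calc ∑ j, P (B j) = ∑ j, ∫⁻ ω, (B j).indicator 1 ω ∂P := by
          simp only [lintegral_indicator_one (hB _)]
      _ = ∫⁻ ω, ∑ j, (B j).indicator 1 ω ∂P :=
          (lintegral_finsetSum _ fun j _ => measurable_one.indicator (hB j)).symm
      _ ≤ ∫⁻ ω, (k : ENNReal) ∂P := by
          apply lintegral_mono_ae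
          filter_upwards [hdist] with ω hω
          have h := card_rk (fun i => S i ω) hω k
          rw [Finset.card_filter] at h
          have h' : ((∑ j, if rk (fun i => S i ω) j < k then 1 else 0 : ℕ) : ENNReal) ≤ k := by
            exact_mod_cast h
          refine le_trans (le_of_eq ?_) h'
          push_cast
          apply Finset.sum_congr rfl
          intro j _
          simp [Set.indicator_apply, B]
      _ = k := by simp
  simp only [heq, Finset.sum_const, Finset.card_univ, Fintype.card_fin, nsmul_eq_mul] at hsum
  have hreal := ENNReal.toReal_mono (ENNReal.natCast_ne_top k) hsum
  rw [ENNReal.toReal_mul, ENNReal.toReal_natCast, ENNReal.toReal_natCast] at hreal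
  push_cast at hreal
  have hmono := ENNReal.toReal_mono (measure_ne_top P _) (measure_mono (μ := P) hsub)
  refine hmono.trans ?_
  have hpos : (0 : ℝ) < n + 1 := by positivity
  rw [show 1 - α + 1 / ((n : ℝ) + 1) = ((1 - α) * (n + 1) + 1) / (n + 1) by field_simp,
    le_div_iff₀ hpos]
  linarith
end
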